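/- arXiv:2206.01275 — 5 statements merged into one kernel-verified Lean document; each statement's English description precedes it below -/
import Mathlib

section
/- Let α and β be complex numbers such that (α + β)² and αβ are coprime non-zero rational integers and α/β is not a root of unity. Let n be an integer with n > 4 and n ≠ 6, n ≠ 12. Then Φ_n(α, β) is a rational integer, the prime P(n/gcd(3,n)) divides Φ_n(α, β) at most to the first power (its square does not divide Φ_n(α, β)), and every prime factor of Φ_n(α, β) other than P(n/gcd(3,n)) is congruent to 1 or −1 modulo n. -/
/-- The greatest prime factor of an integer, with the convention
`P(0) = P(±1) = 1`. -/
def greatestPrimeFactor (m : ℤ) : ℕ := max 1 (m.natAbs.primeFactors.sup id)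

/-- The homogeneous `n`-th cyclotomic polynomial
`Φ_n(x, y) = ∏_{1 ≤ j ≤ n, gcd(j,n) = 1} (x - ζ_n^j y)` where `ζ_n = e^{2πi/n}`. -/
noncomputable def cyclo (n : ℕ) (x y : ℂ) : ℂ :=
  ∏ j ∈ (Finset.Icc 1 n).filter (fun j => Nat.Coprime j n),
    (x - Complex.exp (2 * Real.pi * Complex.I * j / n) * y)

open Polynomial

/-- The homogeneous `n`-th cyclotomic polynomial evaluated in an arbitrary commutative ring. -/
noncomputable def homCyclotomic (n : ℕ) {R : Type*} [CommRing R] (x y : R) : R :=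
  ((cyclotomic n R).scaleRoots y).eval x

theorem eval_scaleRoots_eq_mul_eval_div {K : Type*} [Field K] (p : K[X]) (x : K) {y : K}
    (hy : y ≠ 0) : (p.scaleRoots y).eval x = y ^ p.natDegree * p.eval (x / y) := by
  have h := scaleRoots_eval_mul p (x / y) y
  rwa [mul_comm, div_mul_cancel₀ x hy] at h

theorem map_homCyclotomic {R S : Type*} [CommRing R] [CommRing S] [Nontrivial S] (f : R →+* S)
    (n : ℕ) (x y : R) : f (homCyclotomic n x y) = homCyclotomic n (f x) (f y) := by
  unfold homCyclotomic
  rw [← eval_map_apply, map_scaleRoots _ _ _ (by simp [(cyclotomic.monic n R).leadingCoeff]),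
    map_cyclotomic]

theorem homCyclotomic_eq_prod {n : ℕ} (hn : 0 < n) (x : ℂ) {y : ℂ} (hy : y ≠ 0) :
    homCyclotomic n x y = ∏ μ ∈ primitiveRoots n ℂ, (x - μ * y) := by
  have hroot := Complex.isPrimitiveRoot_exp n hn.ne'
  unfold homCyclotomic
  rw [eval_scaleRoots_eq_mul_eval_div _ _ hy, natDegree_cyclotomic,
    ← Complex.card_primitiveRoots, ← Finset.prod_const,
    cyclotomic_eq_prod_X_sub_primitiveRoots hroot, eval_prod, ← Finset.prod_mul_distrib]
  refine Finset.prod_congr rfl fun μ _ => ?_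
  simp only [eval_sub, eval_X, eval_C]
  field_simp

theorem cyclo_eq_prod {n : ℕ} (hn1 : 1 < n) (x y : ℂ) :
    cyclo n x y = ∏ μ ∈ primitiveRoots n ℂ, (x - μ * y) := by
  have hn : 0 < n := by omega
  have : NeZero n := ⟨hn.ne'⟩
  have hroot := Complex.isPrimitiveRoot_exp n hn.ne'
  have hexp : ∀ j : ℕ, Complex.exp (2 * Real.pi * Complex.I * j / n) =
      Complex.exp (2 * Real.pi * Complex.I / n) ^ j := fun j => by
    rw [← Complex.exp_nat_mul]
    congr 1
    ring
  have hlt : ∀ j ≤ n, j.Coprime n → j < n := fun j hj hc => by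
    refine lt_of_le_of_ne hj ?_
    rintro rfl
    rw [Nat.coprime_self] at hc
    omega
  unfold cyclo
  simp only [hexp]
  refine Finset.prod_bij (fun j _ => Complex.exp (2 * Real.pi * Complex.I / n) ^ j) ?_ ?_ ?_ ?_
  · intro j hj
    rw [mem_primitiveRoots hn]
    exact hroot.pow_of_coprime j (Finset.mem_filter.1 hj).2
  · intro i hi j hj hij
    simp only [Finset.mem_filter, Finset.mem_Icc] at hi hj
    exact hroot.pow_inj (hlt i hi.1.2 hi.2) (hlt j hj.1.2 hj.2) hij
  · intro μ hμ
    rw [mem_primitiveRoots hn] at hμ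
    obtain ⟨i, hi, hcop, rfl⟩ := (hroot.isPrimitiveRoot_iff).1 hμ
    refine ⟨i, ?_, rfl⟩
    simp only [Finset.mem_filter, Finset.mem_Icc]
    refine ⟨⟨Nat.pos_of_ne_zero ?_, hi.le⟩, hcop⟩
    rintro rfl
    rw [Nat.coprime_zero_left] at hcop
    omega
  · intros
    rfl

theorem homCyclotomic_symm {n : ℕ} (hn : 1 < n) {x y : ℂ} (hx : x ≠ 0) (hy : y ≠ 0) :
    homCyclotomic n x y = homCyclotomic n y x := by
  have hn0 : 0 < n := by omega
  have hroot := Complex.isPrimitiveRoot_exp n hn0.ne'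
  have hone : ∏ μ ∈ primitiveRoots n ℂ, (-μ) = 1 := by
    have h := cyclotomic_coeff_zero ℂ hn
    rw [coeff_zero_eq_eval_zero, cyclotomic_eq_prod_X_sub_primitiveRoots hroot, eval_prod] at h
    simpa using h
  rw [homCyclotomic_eq_prod hn0 _ hy, homCyclotomic_eq_prod hn0 _ hx]
  calc ∏ μ ∈ primitiveRoots n ℂ, (x - μ * y)
      = ∏ μ ∈ primitiveRoots n ℂ, (x - μ⁻¹ * y) := by
        refine Finset.prod_nbij' (fun μ => μ⁻¹) (fun μ => μ⁻¹) ?_ ?_ ?_ ?_ ?_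
        · intro μ hμ
          rw [mem_primitiveRoots hn0] at hμ ⊢
          exact hμ.inv
        · intro μ hμ
          rw [mem_primitiveRoots hn0] at hμ ⊢
          exact hμ.inv
        all_goals simp
    _ = (∏ μ ∈ primitiveRoots n ℂ, (-μ)) * ∏ μ ∈ primitiveRoots n ℂ, (x - μ⁻¹ * y) := by
        rw [hone, one_mul]
    _ = ∏ μ ∈ primitiveRoots n ℂ, (y - μ * x) := by
        rw [← Finset.prod_mul_distrib]
        refine Finset.prod_congr rfl fun μ hμ => ?_
        rw [mem_primitiveRoots hn0] at hμ
        have := hμ.ne_zero hn0.ne'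
        field_simp
        ring

/-- Integrality of a complex number that is both rational and an algebraic integer. -/
theorem exists_int_eq_of_isIntegral_of_mul_eq {z : ℂ} (hz : IsIntegral ℤ z) {a b : ℤ}
    (ha : a ≠ 0) (h : (a : ℂ) * z = b) : ∃ c : ℤ, z = c := by
  have ha' : (a : ℂ) ≠ 0 := by exact_mod_cast ha
  have hzq : z = algebraMap ℚ ℂ ((b : ℚ) / a) := by
    simp only [map_div₀, map_intCast]
    field_simp
    rw [← h]
    ring
  rw [hzq, isIntegral_algebraMap_iff (algebraMap ℚ ℂ).injective] at hz
  obtain ⟨c, hc⟩ := IsIntegrallyClosed.isIntegral_iff.1 hz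
  refine ⟨c, ?_⟩
  rw [hzq, ← hc]
  simp

theorem exists_int_add_pow {α β : ℂ} {A B : ℤ} (hA : (α + β) ^ 2 = A) (hB : α * β = B) (k : ℕ) :
    ∃ c : ℤ, α ^ (2 * k) + β ^ (2 * k) = c := by
  induction k using Nat.strong_induction_on with
  | _ k ih =>
    match k with
    | 0 => exact ⟨2, by norm_num⟩
    | 1 => exact ⟨A - 2 * B, by push_cast; rw [← hA, ← hB]; ring⟩
    | k + 2 =>
      obtain ⟨c, hc⟩ := ih k (by omega)
      obtain ⟨d, hd⟩ := ih (k + 1) (by omega)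
      refine ⟨(A - 2 * B) * d - B ^ 2 * c, ?_⟩
      push_cast
      rw [← hc, ← hd, ← hA, ← hB]
      ring

theorem exists_int_symm_monomials {α β : ℂ} {A B : ℤ} (hA : (α + β) ^ 2 = A) (hB : α * β = B)
    {i j : ℕ} (h : Even (i + j)) : ∃ c : ℤ, α ^ i * β ^ j + β ^ i * α ^ j = c := by
  wlog hij : i ≤ j generalizing i j
  · obtain ⟨c, hc⟩ := this (by rwa [add_comm]) (le_of_not_ge hij)
    exact ⟨c, by rw [← hc]; ring⟩
  obtain ⟨k, rfl⟩ : ∃ k, j = i + 2 * k := by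
    obtain ⟨m, hm⟩ := h
    exact ⟨m - i, by omega⟩
  obtain ⟨c, hc⟩ := exists_int_add_pow hA hB k
  refine ⟨B ^ i * c, ?_⟩
  push_cast
  rw [← hc, ← hB]
  ring

theorem exists_int_sub_pow_sq {α β : ℂ} {A B : ℤ} (hA : (α + β) ^ 2 = A) (hB : α * β = B)
    (k : ℕ) : ∃ D : ℤ, (α ^ k - β ^ k) ^ 2 = D := by
  obtain ⟨c, hc⟩ := exists_int_add_pow hA hB k
  refine ⟨c - 2 * B ^ k, ?_⟩
  push_cast
  rw [← hc, ← hB]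
  ring

theorem isIntegral_of_add_sq_of_mul {α β : ℂ} {A B : ℤ} (hA : (α + β) ^ 2 = A)
    (hB : α * β = B) : IsIntegral ℤ α := by
  refine IsIntegral.of_pow (n := 2) (by norm_num) ?_
  refine ⟨X ^ 2 - C (A - 2 * B) * X + C (B ^ 2), ?_, ?_⟩
  · monicity!
  · simp only [eval₂_add, eval₂_sub, eval₂_mul, eval₂_X_pow, eval₂_C, eval₂_X, algebraMap_int_eq,
      Int.coe_castRingHom]
    push_cast
    rw [← hA, ← hB]
    ring

theorem isIntegral_eval_scaleRoots {x y : ℂ} (hx : IsIntegral ℤ x) (hy : IsIntegral ℤ y)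
    (p : ℤ[X]) : IsIntegral ℤ (((p.map (Int.castRingHom ℂ)).scaleRoots y).eval x) := by
  rw [eval_eq_sum_range]
  refine IsIntegral.sum _ fun i _ => ?_
  rw [coeff_scaleRoots, coeff_map]
  exact ((isIntegral_algebraMap (R := ℤ) (x := p.coeff i)).mul (hy.pow _)).mul (hx.pow _)

theorem exists_int_homCyclotomic {α β : ℂ} {A B : ℤ} (hA : (α + β) ^ 2 = A) (hB : α * β = B)
    (hα : α ≠ 0) (hβ : β ≠ 0) {n : ℕ} (hn : 2 < n) : ∃ m : ℤ, homCyclotomic n α β = m := by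
  have hαi := isIntegral_of_add_sq_of_mul hA hB
  have hβi : IsIntegral ℤ β :=
    isIntegral_of_add_sq_of_mul (by rwa [add_comm]) (by rwa [mul_comm] : β * α = B)
  have hint : IsIntegral ℤ (homCyclotomic n α β) := by
    unfold homCyclotomic
    rw [← map_cyclotomic_int]
    exact isIntegral_eval_scaleRoots hαi hβi _
  have hsum : ∃ c : ℤ, homCyclotomic n α β + homCyclotomic n β α = c := by
    have hdeg : (cyclotomic n ℂ).natDegree = n.totient := natDegree_cyclotomic n ℂ
    unfold homCyclotomic
    rw [eval_eq_sum_range, eval_eq_sum_range, natDegree_scaleRoots, natDegree_scaleRoots,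
      ← Finset.sum_add_distrib]
    have key : ∀ i ∈ Finset.range ((cyclotomic n ℂ).natDegree + 1), ∃ c : ℤ,
        ((cyclotomic n ℂ).scaleRoots β).coeff i * α ^ i +
        ((cyclotomic n ℂ).scaleRoots α).coeff i * β ^ i = c := by
      intro i hi
      rw [Finset.mem_range] at hi
      obtain ⟨c, hc⟩ := exists_int_symm_monomials hA hB (i := i)
        (j := (cyclotomic n ℂ).natDegree - i) (by
          rw [Nat.add_sub_cancel' (by omega), hdeg]
          exact Nat.totient_even hn)
      refine ⟨(cyclotomic n ℤ).coeff i * c, ?_⟩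
      rw [coeff_scaleRoots, coeff_scaleRoots]
      push_cast
      rw [← hc, ← map_cyclotomic_int n ℂ, coeff_map, eq_intCast]
      ring
    choose! c hc using key
    exact ⟨∑ i ∈ Finset.range ((cyclotomic n ℂ).natDegree + 1), c i, by
      push_cast
      exact Finset.sum_congr rfl hc⟩
  obtain ⟨c, hc⟩ := hsum
  rw [← homCyclotomic_symm (by omega) hα hβ, ← two_mul] at hc
  exact exists_int_eq_of_isIntegral_of_mul_eq hint (a := 2) two_ne_zero (by exact_mod_cast hc)

theorem exists_rank_of_homCyclotomic_eq_zero {K : Type*} [Field K] {p : ℕ} [hp : Fact p.Prime]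
    [CharP K p] {a b : K} {A B : ℤ} (hA : (a + b) ^ 2 = A) (hB : a * b = B)
    (hcop : IsCoprime A B) {e k : ℕ} (hk : ¬ p ∣ k) (hn : 1 < p ^ e * k)
    (h0 : homCyclotomic (p ^ e * k) a b = 0) :
    (B : K) ≠ 0 ∧ a ^ k = b ^ k ∧ (k ∣ p - 1 ∨ k ∣ p + 1) := by
  have hAB : ¬ ((A : K) = 0 ∧ (B : K) = 0) := by
    rintro ⟨h1, h2⟩
    obtain ⟨u, v, huv⟩ := hcop
    have := congrArg (Int.cast : ℤ → K) huv
    push_cast at this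
    rw [h1, h2] at this
    simp at this
  have hb : b ≠ 0 := by
    rintro rfl
    rw [homCyclotomic, scaleRoots_zero, (cyclotomic.monic _ K).leadingCoeff, one_smul,
      eval_X_pow] at h0
    have ha := eq_zero_of_pow_eq_zero h0
    subst ha
    exact hAB ⟨by rw [← hA]; simp, by rw [← hB]; simp⟩
  have hroot : eval (a / b) (cyclotomic (p ^ e * k) K) = 0 := by
    rw [homCyclotomic, eval_scaleRoots_eq_mul_eval_div _ _ hb] at h0
    exact (mul_eq_zero.1 h0).resolve_left (pow_ne_zero _ hb)
  have ha : a ≠ 0 := by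
    rintro rfl
    rw [zero_div, ← coeff_zero_eq_eval_zero, cyclotomic_coeff_zero K hn] at hroot
    exact one_ne_zero hroot
  have hB0 : (B : K) ≠ 0 := hB ▸ mul_ne_zero ha hb
  have : NeZero (k : K) := ⟨fun h => hk ((CharP.cast_eq_zero_iff K p k).1 h)⟩
  have hprim : IsPrimitiveRoot (a / b) k :=
    isRoot_cyclotomic_prime_pow_mul_iff_of_charP.1 hroot
  set r := a / b with hr
  have hr0 : r ≠ 0 := div_ne_zero ha hb
  have htrace : r + r⁻¹ = ((A - 2 * B : ℤ) : K) / (B : K) := by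
    push_cast
    rw [← hA, ← hB, hr]
    field_simp
    ring
  have hfix : r ^ p + (r ^ p)⁻¹ = r + r⁻¹ := by
    have h := congrArg (frobenius K p) htrace
    rw [map_div₀, map_intCast, map_intCast, ← htrace, map_add, map_inv₀, frobenius_def] at h
    exact h
  refine ⟨hB0, ?_, ?_⟩
  · have h := hprim.pow_eq_one
    rwa [hr, div_pow, div_eq_one_iff_eq (pow_ne_zero _ hb)] at h
  · have hfac : (r ^ p - r) * (r ^ p * r - 1) = 0 := by
      have hrp : r ^ p ≠ 0 := pow_ne_zero _ hr0
      field_simp at hfix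
      linear_combination hfix
    rcases mul_eq_zero.1 hfac with h | h
    · left
      refine hprim.dvd_of_pow_eq_one _ ?_
      have hpp : r ^ p = r ^ (p - 1) * r := by
        rw [← pow_succ, Nat.sub_add_cancel hp.out.one_le]
      refine mul_right_cancel₀ hr0 ?_
      rw [← hpp, one_mul]
      exact sub_eq_zero.1 h
    · right
      refine hprim.dvd_of_pow_eq_one _ ?_
      rw [pow_succ]
      exact sub_eq_zero.1 h

theorem int_dvd_of_integralClosure_dvd {a b : ℤ} (ha : a ≠ 0)
    (h : (a : integralClosure ℤ ℂ) ∣ b) : a ∣ b := by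
  obtain ⟨z, hz⟩ := h
  have hz' : (a : ℂ) * (z : ℂ) = b := by
    have := congrArg (Subtype.val : integralClosure ℤ ℂ → ℂ) hz
    push_cast at this
    exact this.symm
  obtain ⟨c, hc⟩ := exists_int_eq_of_isIntegral_of_mul_eq z.2 ha hz'
  refine ⟨c, ?_⟩
  rw [hc] at hz'
  exact_mod_cast hz'.symm

theorem exists_maximal_ideal_charP {p : ℕ} (hp : p.Prime) :
    ∃ I : Ideal (integralClosure ℤ ℂ), I.IsMaximal ∧ CharP (integralClosure ℤ ℂ ⧸ I) p := by
  have hunit : ¬ IsUnit (p : integralClosure ℤ ℂ) := by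
    intro h
    have hd : ((p : ℤ) : integralClosure ℤ ℂ) ∣ ((1 : ℤ) : integralClosure ℤ ℂ) := by
      push_cast
      exact isUnit_iff_dvd_one.1 h
    have h1 := int_dvd_of_integralClosure_dvd (by exact_mod_cast hp.ne_zero) hd
    exact hp.one_lt.ne' (by exact_mod_cast Int.eq_one_of_dvd_one (by positivity) h1)
  obtain ⟨I, hI, hpI⟩ := exists_max_ideal_of_mem_nonunits hunit
  refine ⟨I, hI, ?_⟩
  have : Nontrivial (integralClosure ℤ ℂ ⧸ I) := Ideal.Quotient.nontrivial_iff.2 hI.ne_top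
  rw [CharP.charP_iff_prime_eq_zero hp]
  have := Ideal.Quotient.eq_zero_iff_mem.2 hpI
  simpa using this

theorem rank_dvd_of_prime_dvd_homCyclotomic {α β : integralClosure ℤ ℂ} {A B m : ℤ}
    (hA : (α + β) ^ 2 = A) (hB : α * β = B) (hcop : IsCoprime A B) {p e k : ℕ} (hp : p.Prime)
    (hk : ¬ p ∣ k) (hn : 1 < p ^ e * k) (hm : homCyclotomic (p ^ e * k) α β = m)
    (hpm : (p : ℤ) ∣ m) :
    ¬ (p : ℤ) ∣ B ∧ (k ∣ p - 1 ∨ k ∣ p + 1) ∧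
      ∀ j : ℕ, k ∣ j → ∀ D : ℤ, (α ^ j - β ^ j) ^ 2 = D → (p : ℤ) ∣ D := by
  obtain ⟨I, hI, hchar⟩ := exists_maximal_ideal_charP hp
  let := Ideal.Quotient.field I
  have : Fact p.Prime := ⟨hp⟩
  set f := Ideal.Quotient.mk I
  have hcast : ∀ z : ℤ, f z = z := fun z => map_intCast f z
  have h0 : homCyclotomic (p ^ e * k) (f α) (f β) = 0 := by
    rw [← map_homCyclotomic, hm, hcast]
    exact (CharP.intCast_eq_zero_iff _ p m).2 hpm
  obtain ⟨h1, h2, h3⟩ := exists_rank_of_homCyclotomic_eq_zero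
    (by rw [← map_add, ← map_pow, hA, hcast]) (by rw [← map_mul, hB, hcast]) hcop hk hn h0
  refine ⟨fun h => h1 ((CharP.intCast_eq_zero_iff _ p B).2 h), h3, ?_⟩
  rintro j ⟨i, rfl⟩ D hD
  rw [← CharP.intCast_eq_zero_iff (integralClosure ℤ ℂ ⧸ I) p D, ← hcast, ← hD]
  simp [pow_mul, h2]

theorem exists_add_pow_eq_of_two_lt {R : Type*} [CommRing R] {p : ℕ} (hp : p.Prime) (hp2 : 2 < p)
    (x y : R) : ∃ w, (x + y) ^ p = y ^ p + p * x * y ^ (p - 1) + x ^ p + p * x ^ 2 * w := by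
  obtain ⟨q, rfl⟩ : ∃ q, p = q + 2 := ⟨p - 2, by omega⟩
  have hd : ∀ i ∈ Finset.range q, ((q + 2 : ℕ) : R) * x ^ 2 ∣
      x ^ (i + 1 + 1) * y ^ (q + 2 - (i + 1 + 1)) * ((q + 2).choose (i + 1 + 1) : ℕ) := by
    intro i hi
    rw [Finset.mem_range] at hi
    obtain ⟨c, hc⟩ := hp.dvd_choose_self (k := i + 1 + 1) (by omega) (by omega)
    refine ⟨x ^ i * y ^ (q + 2 - (i + 1 + 1)) * c, ?_⟩
    rw [hc]
    push_cast
    ring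
  obtain ⟨w, hw⟩ := Finset.dvd_sum hd
  refine ⟨w, ?_⟩
  rw [add_pow, Finset.sum_range_succ, Finset.sum_range_succ', Finset.sum_range_succ', hw]
  simp
  ring

theorem eval_scaleRoots_X_pow_sub_one {R : Type*} [CommRing R] [Nontrivial R] {n : ℕ}
    (hn : 0 < n) (x y : R) : ((X ^ n - 1 : R[X]).scaleRoots y).eval x = x ^ n - y ^ n := by
  have h : (X ^ n - 1 : R[X]).scaleRoots y = X ^ n - C (y ^ n) := by
    ext i
    have hdeg : (X ^ n - 1 : R[X]).natDegree = n := by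
      simpa using natDegree_X_pow_sub_C (R := R) (n := n) (r := 1)
    rw [coeff_scaleRoots, hdeg, coeff_sub, coeff_sub, coeff_X_pow, coeff_one, coeff_C]
    rcases eq_or_ne i n with rfl | hi
    · simp [hn.ne']
    · rcases eq_or_ne i 0 with rfl | hi0
      · simp [hi]
      · simp [hi, hi0]
  rw [h]
  simp

theorem exists_homCyclotomic_mul_eq {R : Type*} [CommRing R] [IsDomain R] {n d : ℕ}
    (hd : d ∈ n.properDivisors) (x y : R) :
    ∃ c, homCyclotomic n x y * c * (x ^ d - y ^ d) = x ^ n - y ^ n := by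
  obtain ⟨c, hc⟩ := X_pow_sub_one_mul_cyclotomic_dvd_X_pow_sub_one_of_dvd R hd
  have hlt := (Nat.mem_properDivisors.1 hd).2
  have hd0 : 0 < d := Nat.pos_of_mem_properDivisors hd
  refine ⟨(c.scaleRoots y).eval x, ?_⟩
  have h := eval_scaleRoots_X_pow_sub_one (n := n) (by omega) x y
  rw [hc, mul_scaleRoots_of_noZeroDivisors, mul_scaleRoots_of_noZeroDivisors, eval_mul, eval_mul,
    eval_scaleRoots_X_pow_sub_one hd0] at h
  rw [← h, homCyclotomic]
  ring

theorem prime_dvd_of_dvd_pow_integralClosure {α β : integralClosure ℤ ℂ} {B : ℤ}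
    (hB : α * β = B) {p : ℕ} (hp : p.Prime) {i : ℕ}
    (h : (p : integralClosure ℤ ℂ) ∣ β ^ i) : (p : ℤ) ∣ B := by
  have h1 : ((p : ℤ) : integralClosure ℤ ℂ) ∣ ((B ^ i : ℤ) : integralClosure ℤ ℂ) := by
    push_cast
    rw [← hB, mul_pow]
    exact h.mul_left _
  exact (Nat.prime_iff_prime_int.1 hp).dvd_of_dvd_pow
    (int_dvd_of_integralClosure_dvd (by exact_mod_cast hp.ne_zero) h1)

theorem not_sq_dvd_homCyclotomic_two {α β : integralClosure ℤ ℂ} {B m : ℤ}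
    (hB : α * β = B) (hnr : ∀ k : ℕ, 0 < k → α ^ k ≠ β ^ k) (hB2 : ¬ (2 : ℤ) ∣ B) {j : ℕ}
    (hj : 0 < j) (hm : homCyclotomic (8 * j) α β = m) {D : ℤ} (hD : (α ^ j - β ^ j) ^ 2 = D)
    (hD2 : (2 : ℤ) ∣ D) : ¬ (2 : ℤ) ^ 2 ∣ m := by
  rintro ⟨s, rfl⟩
  obtain ⟨t, rfl⟩ := hD2
  obtain ⟨c, hc⟩ := exists_homCyclotomic_mul_eq (n := 8 * j) (d := 4 * j)
    (Nat.mem_properDivisors.2 ⟨⟨2, by ring⟩, by omega⟩) α β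
  rw [hm] at hc
  push_cast at hc hD
  have hγ : α ^ (4 * j) - β ^ (4 * j) ≠ 0 := sub_ne_zero.2 (hnr _ (by omega))
  have hQ : 2 ^ 2 * (s : integralClosure ℤ ℂ) * c = α ^ (4 * j) + β ^ (4 * j) := by
    refine mul_right_cancel₀ hγ ?_
    linear_combination hc
  have hsq : α ^ (2 * j) - β ^ (2 * j) = 2 * (t + (α ^ j - β ^ j) * β ^ j) := by
    linear_combination hD
  have hfour : α ^ (4 * j) - β ^ (4 * j) =
      4 * ((t + (α ^ j - β ^ j) * β ^ j) * (t + (α ^ j - β ^ j) * β ^ j + β ^ (2 * j))) := by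
    have : α ^ (4 * j) - β ^ (4 * j) = (α ^ (2 * j) - β ^ (2 * j)) *
        ((α ^ (2 * j) - β ^ (2 * j)) + 2 * β ^ (2 * j)) := by ring
    rw [this, hsq]
    ring
  refine hB2 (prime_dvd_of_dvd_pow_integralClosure hB Nat.prime_two (i := 4 * j) ?_)
  refine ⟨s * c - (t + (α ^ j - β ^ j) * β ^ j) *
    (t + (α ^ j - β ^ j) * β ^ j + β ^ (2 * j)), ?_⟩
  refine mul_left_cancel₀ (two_ne_zero (α := integralClosure ℤ ℂ)) ?_
  push_cast
  linear_combination -hfour - hQ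

theorem not_sq_dvd_homCyclotomic_odd {α β : integralClosure ℤ ℂ} {B m : ℤ}
    (hB : α * β = B) (hnr : ∀ k : ℕ, 0 < k → α ^ k ≠ β ^ k) {p : ℕ} (hp : p.Prime)
    (hp2 : 2 < p) (hBp : ¬ (p : ℤ) ∣ B) {q : ℕ} (hq : 0 < q)
    (hm : homCyclotomic (q * p) α β = m)
    (h1 : (p : integralClosure ℤ ℂ) ∣ (α ^ q - β ^ q) ^ 2)
    (h2 : (p : integralClosure ℤ ℂ) ^ 2 ∣ (α ^ q - β ^ q) ^ (p - 1)) : ¬ (p : ℤ) ^ 2 ∣ m := by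
  rintro ⟨s, rfl⟩
  obtain ⟨c, hc⟩ := exists_homCyclotomic_mul_eq (n := q * p) (d := q)
    (Nat.mem_properDivisors.2 ⟨dvd_mul_right _ _, by nlinarith⟩) α β
  rw [hm, pow_mul, pow_mul] at hc
  push_cast at hc
  have hγ : α ^ q - β ^ q ≠ 0 := sub_ne_zero.2 (hnr _ hq)
  obtain ⟨w, hw⟩ := exists_add_pow_eq_of_two_lt hp hp2 (α ^ q - β ^ q) (β ^ q)
  rw [sub_add_cancel] at hw
  rw [hw] at hc
  generalize α ^ q - β ^ q = γ at *
  obtain ⟨u, hu⟩ := h1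
  obtain ⟨v, hv⟩ := h2
  have hp0 : (p : integralClosure ℤ ℂ) ≠ 0 := by exact_mod_cast hp.ne_zero
  have hpp : γ ^ p = γ ^ (p - 1) * γ := by rw [← pow_succ, Nat.sub_add_cancel hp.one_le]
  have hδ : (β ^ q) ^ (p - 1) = p * (s * c - v) - γ * w := by
    refine mul_left_cancel₀ hp0 (mul_right_cancel₀ hγ ?_)
    rw [hpp, hv] at hc
    linear_combination -hc
  refine hBp (prime_dvd_of_dvd_pow_integralClosure hB hp (i := q * (p - 1) * 2) ?_)
  rw [pow_mul, pow_mul, hδ]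
  refine ⟨p * (s * c - v) ^ 2 - 2 * (s * c - v) * γ * w + u * w ^ 2, ?_⟩
  linear_combination w ^ 2 * hu

theorem not_sq_dvd_homCyclotomic {α β : integralClosure ℤ ℂ} {A B m : ℤ}
    (hA : (α + β) ^ 2 = A) (hB : α * β = B) (hcop : IsCoprime A B)
    (hnr : ∀ k : ℕ, 0 < k → α ^ k ≠ β ^ k)
    (hsq : ∀ k : ℕ, ∃ D : ℤ, (α ^ k - β ^ k) ^ 2 = D) {n : ℕ} (hn : 4 < n) (hn6 : n ≠ 6)
    (hn12 : n ≠ 12) (hm : homCyclotomic n α β = m) {p : ℕ} (hp : p.Prime) (hpn : p ∣ n) :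
    ¬ (p : ℤ) ^ 2 ∣ m := by
  intro hdvd
  obtain ⟨e, k, hk, rfl⟩ := Nat.exists_eq_pow_mul_and_not_dvd (n := n) (by omega) p hp.ne_one
  have hk0 : 0 < k := Nat.pos_of_ne_zero (by rintro rfl; simp at hk)
  obtain ⟨hBp, hkp, hD⟩ := rank_dvd_of_prime_dvd_homCyclotomic hA hB hcop hp hk (by omega) hm
    ((dvd_pow_self _ two_ne_zero).trans hdvd)
  obtain ⟨e, rfl⟩ : ∃ e', e = e' + 1 := by
    refine Nat.exists_eq_succ_of_ne_zero ?_
    rintro rfl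
    simp only [pow_zero, one_mul] at hpn
    exact hk hpn
  have hk_le : k ≤ p + 1 := by
    rcases hkp with h | h
    · exact (Nat.le_of_dvd (by have := hp.two_le; omega) h).trans (by omega)
    · exact Nat.le_of_dvd (by omega) h
  rcases hp.two_le.eq_or_lt with rfl | hp2
  · obtain ⟨e, rfl⟩ : ∃ e', e = e' + 2 := by
      refine ⟨e - 2, ?_⟩
      by_contra hne
      have he : e < 2 := by omega
      interval_cases e <;> interval_cases k <;> omega
    obtain ⟨D, hD'⟩ := hsq (2 ^ e * k)
    refine not_sq_dvd_homCyclotomic_two hB hnr (by exact_mod_cast hBp) (j := 2 ^ e * k)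
      (by positivity) (by rw [← hm]; congr 1; ring) hD' ?_ (by exact_mod_cast hdvd)
    exact_mod_cast hD _ (dvd_mul_left _ _) D hD'
  · have key : ∀ j, k ∣ j → (p : integralClosure ℤ ℂ) ∣ (α ^ j - β ^ j) ^ 2 := by
      intro j hj
      obtain ⟨D, hD'⟩ := hsq j
      obtain ⟨t, rfl⟩ := hD j hj D hD'
      rw [hD']
      push_cast
      exact dvd_mul_right _ _
    refine not_sq_dvd_homCyclotomic_odd hB hnr hp hp2 hBp (q := p ^ e * k)
      (have := hp.pos; by positivity) (by rw [← hm]; congr 1; ring) (key _ (dvd_mul_left _ _)) ?_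
      hdvd
    rcases (show 3 ≤ p from hp2).eq_or_lt with rfl | hp3
    · obtain ⟨e, rfl⟩ : ∃ e', e = e' + 1 := by
        refine Nat.exists_eq_succ_of_ne_zero ?_
        rintro rfl
        interval_cases k <;> omega
      obtain ⟨t, ht⟩ := key (3 ^ e * k) (dvd_mul_left _ _)
      push_cast at ht ⊢
      have h3 : 3 ^ (e + 1) * k = 3 ^ e * k * 3 := by ring
      rw [h3, pow_mul α, pow_mul β]
      generalize α ^ (3 ^ e * k) = a at *
      generalize β ^ (3 ^ e * k) = b at *
      have hcube : a ^ 3 - b ^ 3 = (a - b) * (3 * (t + (a - b) * b + b ^ 2)) := by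
        linear_combination (a - b) * ht
      rw [hcube]
      exact ⟨(a - b) ^ 2 * (t + (a - b) * b + b ^ 2) ^ 2, by ring⟩
    · obtain ⟨p', rfl⟩ : ∃ p', p = p' + 5 := by
        refine ⟨p - 5, ?_⟩
        have : p ≠ 4 := by rintro rfl; norm_num at hp
        omega
      have h := pow_dvd_pow_of_dvd (key ((p' + 5) ^ e * k) (dvd_mul_left _ _)) 2
      rw [← pow_mul] at h
      exact h.trans (pow_dvd_pow _ (by omega))

theorem greatestPrimeFactor_natCast_prime {m : ℕ} (hm : 1 < m) :
    (greatestPrimeFactor (m : ℤ)).Prime ∧ greatestPrimeFactor (m : ℤ) ∣ m := by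
  have hne : m.primeFactors.Nonempty := Nat.nonempty_primeFactors.2 hm
  obtain ⟨q, hq, hsup⟩ := Finset.exists_mem_eq_sup _ hne id
  have hqp := Nat.prime_of_mem_primeFactors hq
  have h : greatestPrimeFactor (m : ℤ) = q := by
    rw [greatestPrimeFactor, Int.natAbs_natCast, hsup]
    exact max_eq_right hqp.one_le
  rw [h]
  exact ⟨hqp, Nat.dvd_of_mem_primeFactors hq⟩

theorem eq_greatestPrimeFactor {m p : ℕ} (hm : m ≠ 0) (hp : p.Prime) (hpm : p ∣ m)
    (hle : ∀ q : ℕ, q.Prime → q ∣ m → q ≤ p) : p = greatestPrimeFactor (m : ℤ) := by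
  rw [greatestPrimeFactor, Int.natAbs_natCast]
  refine le_antisymm ?_ (max_le hp.one_le (Finset.sup_le fun q hq => hle q
    (Nat.prime_of_mem_primeFactors hq) (Nat.dvd_of_mem_primeFactors hq)))
  exact le_max_of_le_right
    (Finset.le_sup (f := id) (Nat.mem_primeFactors.2 ⟨hp, hpm, hm⟩))

theorem eq_greatestPrimeFactor_div_gcd_three {p e k : ℕ} (hp : p.Prime) (he : 0 < e)
    (hk : ¬ p ∣ k) (hkp : k ∣ p - 1 ∨ k ∣ p + 1) (hn : 4 < p ^ e * k) (hn6 : p ^ e * k ≠ 6)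
    (hn12 : p ^ e * k ≠ 12) :
    p = greatestPrimeFactor ((p ^ e * k / Nat.gcd 3 (p ^ e * k) : ℕ) : ℤ) := by
  set n := p ^ e * k with hndef
  have hn0 : 0 < n := by omega
  have hk0 : 0 < k := Nat.pos_of_ne_zero (by rintro rfl; simp at hk)
  have hgn : Nat.gcd 3 n ∣ n := Nat.gcd_dvd_right _ _
  have hpn : p ∣ n := (dvd_pow_self p he.ne').mul_right k
  have hmul : Nat.gcd 3 n * (n / Nat.gcd 3 n) = n := Nat.mul_div_cancel' hgn
  have hm0 : n / Nat.gcd 3 n ≠ 0 := by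
    intro h
    rw [h] at hmul
    omega
  have hg : Nat.gcd 3 n = 1 ∨ Nat.gcd 3 n = 3 :=
    (Nat.dvd_prime Nat.prime_three).1 (Nat.gcd_dvd_left _ _)
  refine eq_greatestPrimeFactor hm0 hp ?_ ?_
  · by_cases hp3 : p = 3
    · subst hp3
      have he2 : 2 ≤ e := by
        by_contra hne
        have he1 : e = 1 := by omega
        subst he1
        have hk4 : k ≤ 4 := by
          rcases hkp with h | h
          · exact (Nat.le_of_dvd (by norm_num) h).trans (by norm_num)
          · exact Nat.le_of_dvd (by norm_num) h
        interval_cases k <;> omega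
      have h9 : 3 ^ 2 ∣ n := (pow_dvd_pow 3 he2).mul_right k
      rcases hg with h | h <;> rw [h] <;> omega
    · rcases hg with h | h
      · rwa [h, Nat.div_one]
      · rw [← hmul, h] at hpn
        rw [h]
        exact (hp.dvd_mul.1 hpn).resolve_left fun h' =>
          hp3 ((Nat.prime_dvd_prime_iff_eq hp Nat.prime_three).1 h')
  · intro q hq hqm
    have hqn : q ∣ n := hqm.trans (Nat.div_dvd_of_dvd hgn)
    rcases hq.dvd_mul.1 (hndef ▸ hqn) with h | h
    · exact ((Nat.prime_dvd_prime_iff_eq hq hp).1 (hq.dvd_of_dvd_pow h)).le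
    · have hqp : q ∣ p - 1 ∨ q ∣ p + 1 := hkp.imp h.trans h.trans
      by_contra hlt
      have hq1 : q = p + 1 := by
        rcases hqp with h' | h'
        · have := Nat.le_of_dvd (by have := hp.two_le; omega) h'
          omega
        · have := Nat.le_of_dvd (by omega) h'
          omega
      have hp2 : p = 2 := by
        rcases hp.eq_two_or_odd' with h' | h'
        · exact h'
        · have h2 : 2 ∣ q := hq1 ▸ h'.add_one.two_dvd
          have := (Nat.prime_dvd_prime_iff_eq Nat.prime_two hq).1 h2
          have := hp.two_le
          omega
      subst hp2
      have hq3 : q = 3 := hq1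
      subst hq3
      have hk3 : k = 3 := by
        rcases hkp with h' | h'
        · have := Nat.le_of_dvd (by norm_num) h'
          have := Nat.le_of_dvd hk0 h
          omega
        · exact Nat.dvd_antisymm h' h
      have hg3 : Nat.gcd 3 n = 3 := Nat.gcd_eq_left hqn
      rw [hg3, hndef, hk3, Nat.mul_div_cancel _ (by norm_num)] at hqm
      have := Nat.prime_three.dvd_of_dvd_pow hqm
      omega

theorem natCast_zmod_eq_one_or_neg_one {p k : ℕ} (hp : 0 < p) (h : k ∣ p - 1 ∨ k ∣ p + 1) :
    (p : ZMod k) = 1 ∨ (p : ZMod k) = -1 := by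
  refine h.imp (fun h => ?_) fun h => ?_
  · have := (ZMod.natCast_eq_zero_iff (p - 1) k).2 h
    rwa [Nat.cast_sub hp, Nat.cast_one, sub_eq_zero] at this
  · have := (ZMod.natCast_eq_zero_iff (p + 1) k).2 h
    rwa [Nat.cast_add, Nat.cast_one, add_eq_zero_iff_eq_neg] at this

/-- Let `α, β` be complex numbers with `(α+β)^2` and `αβ` coprime non-zero integers
and `α/β` not a root of unity.  For `n > 4`, `n ≠ 6, 12`, the value `Φ_n(α,β)` is a
rational integer, the prime `P(n / gcd(3,n))` divides it at most to the first power,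
and all its other prime factors are congruent to `±1 (mod n)`. -/
theorem stmt2 (α β : ℂ) (A B : ℤ)
    (hA : (α + β) ^ 2 = (A : ℂ)) (hB : α * β = (B : ℂ))
    (hA0 : A ≠ 0) (hB0 : B ≠ 0) (hcop : IsCoprime A B)
    (hnru : ∀ k : ℕ, 0 < k → (α / β) ^ k ≠ 1)
    (n : ℕ) (hn : 4 < n) (hn6 : n ≠ 6) (hn12 : n ≠ 12) :
    ∃ m : ℤ, cyclo n α β = (m : ℂ) ∧
      ¬ ((greatestPrimeFactor ((n / Nat.gcd 3 n : ℕ) : ℤ) : ℤ) ^ 2 ∣ m) ∧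
      ∀ p : ℕ, p.Prime → (p : ℤ) ∣ m →
        p ≠ greatestPrimeFactor ((n / Nat.gcd 3 n : ℕ) : ℤ) →
        ((p : ZMod n) = 1 ∨ (p : ZMod n) = -1) := by
  have hαβ : α * β ≠ 0 := by rw [hB]; exact_mod_cast hB0
  have hα : α ≠ 0 := left_ne_zero_of_mul hαβ
  have hβ : β ≠ 0 := right_ne_zero_of_mul hαβ
  obtain ⟨m, hm⟩ := exists_int_homCyclotomic hA hB hα hβ (show 2 < n by omega)
  have hcyc : cyclo n α β = m := by
    rw [cyclo_eq_prod (by omega), ← hm, homCyclotomic_eq_prod (by omega) _ hβ]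
  let a : integralClosure ℤ ℂ := ⟨α, isIntegral_of_add_sq_of_mul hA hB⟩
  let b : integralClosure ℤ ℂ := ⟨β, isIntegral_of_add_sq_of_mul
    (by rwa [add_comm]) (by rwa [mul_comm] : β * α = B)⟩
  have hA' : (a + b) ^ 2 = A := Subtype.ext (by push_cast; exact hA)
  have hB' : a * b = B := Subtype.ext (by push_cast; exact hB)
  have hm' : homCyclotomic n a b = m := by
    refine Subtype.ext ?_
    have h := map_homCyclotomic (integralClosure ℤ ℂ).val.toRingHom n a b
    push_cast
    exact h.trans hm
  have hnr : ∀ k : ℕ, 0 < k → a ^ k ≠ b ^ k := by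
    intro k hk h
    have h' : α ^ k = β ^ k := by
      have := congrArg Subtype.val h
      push_cast at this
      exact this
    refine hnru k hk ?_
    rw [div_pow, h', div_self (pow_ne_zero _ hβ)]
  have hsq : ∀ k : ℕ, ∃ D : ℤ, (a ^ k - b ^ k) ^ 2 = D := by
    intro k
    obtain ⟨D, hD⟩ := exists_int_sub_pow_sq hA hB k
    exact ⟨D, Subtype.ext (by push_cast; exact hD)⟩
  refine ⟨m, hcyc, ?_, ?_⟩
  · have hdiv : n / Nat.gcd 3 n ∣ n := Nat.div_dvd_of_dvd (Nat.gcd_dvd_right _ _)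
    have hlt : 1 < n / Nat.gcd 3 n := by
      have hle : Nat.gcd 3 n ≤ 3 := Nat.gcd_le_left _ (by norm_num)
      have hmul : Nat.gcd 3 n * (n / Nat.gcd 3 n) = n :=
        Nat.mul_div_cancel' (Nat.gcd_dvd_right _ _)
      by_contra! hcon
      nlinarith
    obtain ⟨hP, hPd⟩ := greatestPrimeFactor_natCast_prime hlt
    exact not_sq_dvd_homCyclotomic hA' hB' hcop hnr hsq hn hn6 hn12 hm' hP (hPd.trans hdiv)
  · intro p hp hpm hne
    obtain ⟨e, k, hk, hnk⟩ := Nat.exists_eq_pow_mul_and_not_dvd (n := n) (by omega) p hp.ne_one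
    subst hnk
    obtain ⟨-, hkp, -⟩ := rank_dvd_of_prime_dvd_homCyclotomic hA' hB' hcop hp hk (by omega) hm' hpm
    rcases Nat.eq_zero_or_pos e with rfl | he
    · exact natCast_zmod_eq_one_or_neg_one hp.pos (by rwa [pow_zero, one_mul])
    · exact absurd (eq_greatestPrimeFactor_div_gcd_three hp he hk hkp hn hn6 hn12) hne
end

section
/- Let (t_n) be a Lucas sequence and let p be a prime number which does not divide αβ. Then p divides t_n for some positive integer n, and the smallest positive integer ℓ for which p divides t_ℓ satisfies ℓ ≤ p + 1. -/
/-- d'Ocagne's identity for a solution of a second order linear recurrence starting at `0, 1`. -/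
lemma docagne_of_recurrence {R : Type*} [CommRing R] {r s : R} {u : ℕ → R}
    (h0 : u 0 = 0) (h1 : u 1 = 1) (hu : ∀ n, u (n + 2) = r * u (n + 1) + s * u n) (i d : ℕ) :
    u (i + 1) * u (i + d) - u (i + d + 1) * u i = (-s) ^ i * u d := by
  induction i with
  | zero => simp [h0, h1]
  | succ i ih =>
    rw [show i + 1 + d + 1 = i + d + 2 by ring, show i + 1 + d = i + d + 1 by ring, hu, hu,
      pow_succ]
    linear_combination (-s) * ih

/-- Over a finite field with `q` elements, a solution of a nondegenerate second order linear
recurrence starting at `0, 1` vanishes at a positive index at most `q + 1`. -/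
lemma exists_zero_of_recurrence {K : Type*} [Field K] [Fintype K] {r s : K} {u : ℕ → K}
    (hs : s ≠ 0) (h0 : u 0 = 0) (h1 : u 1 = 1)
    (hu : ∀ n, u (n + 2) = r * u (n + 1) + s * u n) :
    ∃ n, 0 < n ∧ n ≤ Fintype.card K + 1 ∧ u n = 0 := by
  classical
  by_contra! hne
  have key : ∀ i j, 0 < i → i < j → j ≤ Fintype.card K → u (i + 1) / u i ≠ u (j + 1) / u j := by
    intro i j hi hij hj h
    obtain ⟨d, rfl⟩ := Nat.exists_eq_add_of_le hij.le
    rw [div_eq_div_iff (hne i hi (by lia)) (hne _ (by lia) (by lia))] at h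
    have hd := docagne_of_recurrence h0 h1 hu i d
    rw [h, sub_self] at hd
    exact mul_ne_zero (pow_ne_zero i (neg_ne_zero.mpr hs)) (hne d (by lia) (by lia)) hd.symm
  have hcard : (Finset.univ.erase (0 : K)).card < (Finset.Icc 1 (Fintype.card K)).card := by
    rw [Finset.card_erase_of_mem (Finset.mem_univ _), Finset.card_univ, Nat.card_Icc]
    have := Fintype.card_pos (α := K)
    lia
  obtain ⟨i, hi, j, hj, hij, h⟩ := Finset.exists_ne_map_eq_of_card_lt_of_maps_to
    (f := fun n => u (n + 1) / u n) hcard (by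
      intro n hn
      have hn' := Finset.mem_Icc.mp hn
      simpa using ⟨hne (n + 1) (by lia) (by lia), hne n (by lia) (by lia)⟩)
  rw [Finset.mem_Icc] at hi hj
  rcases hij.lt_or_gt with hlt | hlt
  · exact key i j (by lia) hlt hj.2 h
  · exact key j i (by lia) hlt hi.2 h.symm

/-- Let `(t n)` be a Lucas sequence and `p` a prime not dividing `αβ = -s`.
Then `p` divides some `t n` with `n > 0`, and the least such `n` is at most `p + 1`. -/
theorem stmt5 (r s : ℤ) (α β : ℂ) (t : ℕ → ℤ)
    (hrs : r ^ 2 + 4 * s ≠ 0)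
    (hsum : α + β = (r : ℂ)) (hprod : α * β = -(s : ℂ))
    (hαβ : α ≠ β) (hαβ0 : α * β ≠ 0)
    (hnru : ∀ k : ℕ, 0 < k → (α / β) ^ k ≠ 1)
    (ht : ∀ n : ℕ, (t n : ℂ) = (α ^ n - β ^ n) / (α - β))
    (p : ℕ) (hp : p.Prime) (hps : ¬ (p : ℤ) ∣ s) :
    (∃ n : ℕ, 0 < n ∧ (p : ℤ) ∣ t n) ∧
      ∀ l : ℕ, IsLeast {n : ℕ | 0 < n ∧ (p : ℤ) ∣ t n} l → l ≤ p + 1 := by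
  have hsub : α - β ≠ 0 := sub_ne_zero.mpr hαβ
  have h0 : t 0 = 0 := by
    have := ht 0
    simpa using this
  have h1 : t 1 = 1 := by
    have := ht 1
    rw [pow_one, pow_one, div_self hsub] at this
    exact_mod_cast this
  have hrec : ∀ n, t (n + 2) = r * t (n + 1) + s * t n := by
    intro n
    have h : (t (n + 2) : ℂ) = r * t (n + 1) + s * t n := by
      rw [ht, ht, ht, ← hsum, show (s : ℂ) = -(α * β) by rw [hprod, neg_neg]]
      field_simp
      ring
    exact_mod_cast h
  have : Fact p.Prime := ⟨hp⟩
  obtain ⟨n, hn, hnp, hzero⟩ := exists_zero_of_recurrence (K := ZMod p) (r := r) (s := s)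
    (u := fun n => (t n : ZMod p)) (by rwa [Ne, ZMod.intCast_zmod_eq_zero_iff_dvd])
    (by simp [h0]) (by simp [h1]) (fun n => by simp [hrec])
  rw [ZMod.card] at hnp
  have hdvd : (p : ℤ) ∣ t n := (ZMod.intCast_zmod_eq_zero_iff_dvd _ _).mp hzero
  exact ⟨⟨n, hn, hdvd⟩, fun l hl => (hl.2 ⟨hn, hdvd⟩).trans hnp⟩
end

section
/- Let (t_n) be a Lucas sequence with α + β and αβ coprime. Let p be an odd prime which does not divide αβ and let ℓ be the smallest positive integer for which p divides t_ℓ. If n = ℓk for a positive integer k, then ord_p(t_n) = ord_p(t_ℓ) + ord_p(k); equivalently |t_n|_p = |t_ℓ|_p·|k|_p. -/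
/-- If `α ^ m = T α + c` and `β ^ m = T β + c`, then the binomial theorem expands the `m * k`-th
term of the Lucas sequence of `α`, `β` in powers of `T`. -/
theorem lucas_mul_eq_sum {α β : ℂ} {t : ℕ → ℤ}
    (ht : ∀ n : ℕ, (t n : ℂ) = (α ^ n - β ^ n) / (α - β)) {m : ℕ} {T c : ℤ}
    (hα : α ^ m = T * α + c) (hβ : β ^ m = T * β + c) (k : ℕ) :
    t (m * k) = ∑ j ∈ Finset.range (k + 1), T ^ j * t j * c ^ (k - j) * (k.choose j : ℤ) := by
  have h : (t (m * k) : ℂ) =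
      ∑ j ∈ Finset.range (k + 1), (T : ℂ) ^ j * t j * c ^ (k - j) * (k.choose j : ℂ) := by
    rw [ht, pow_mul, pow_mul, hα, hβ, add_pow, add_pow, ← Finset.sum_sub_distrib, Finset.sum_div]
    refine Finset.sum_congr rfl fun j _ => ?_
    rw [ht, mul_pow, mul_pow]
    ring
  exact_mod_cast h

/-- If `d * T ^ 2` divides every term of degree at least two in the expansion of the `m * k`-th
term, then that term is `k * c ^ (k - 1) * T` up to a multiple of `d * T ^ 2`. -/
theorem exists_lucas_mul_eq {α β : ℂ} {t : ℕ → ℤ} (hαβ : α ≠ β)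
    (ht : ∀ n : ℕ, (t n : ℂ) = (α ^ n - β ^ n) / (α - β)) {m : ℕ} {T c d : ℤ}
    (hα : α ^ m = T * α + c) (hβ : β ^ m = T * β + c) {k : ℕ} (hk : 0 < k)
    (hd : ∀ j, 2 ≤ j → j ≤ k → d * T ^ 2 ∣ T ^ j * (k.choose j : ℤ)) :
    ∃ w : ℤ, t (m * k) = k * c ^ (k - 1) * T + d * T ^ 2 * w := by
  have hsub : α - β ≠ 0 := sub_ne_zero.mpr hαβ
  have h0 : t 0 = 0 := by
    have h := ht 0
    simp only [pow_zero, sub_self, zero_div] at h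
    exact_mod_cast h
  have h1 : t 1 = 1 := by
    have h := ht 1
    rw [pow_one, pow_one, div_self hsub] at h
    exact_mod_cast h
  obtain ⟨q, rfl⟩ : ∃ q, k = q + 1 := ⟨k - 1, by omega⟩
  rw [lucas_mul_eq_sum ht hα hβ, Finset.sum_range_succ', Finset.sum_range_succ']
  have hdvd : d * T ^ 2 ∣ ∑ j ∈ Finset.range q,
      T ^ (j + 1 + 1) * t (j + 1 + 1) * c ^ (q + 1 - (j + 1 + 1)) *
        ((q + 1).choose (j + 1 + 1) : ℤ) := by
    refine Finset.dvd_sum fun j hj => ?_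
    rw [Finset.mem_range] at hj
    obtain ⟨w, hw⟩ := hd (j + 1 + 1) (by omega) (by omega)
    exact ⟨w * (t (j + 1 + 1) * c ^ (q + 1 - (j + 1 + 1))), by
      linear_combination (t (j + 1 + 1) * c ^ (q + 1 - (j + 1 + 1))) * hw⟩
  obtain ⟨w, hw⟩ := hdvd
  refine ⟨w, ?_⟩
  rw [hw]
  simp only [h0, h1, zero_add, Nat.choose_one_right, Nat.add_sub_cancel]
  ring

theorem lucas_ne_zero {α β : ℂ} {t : ℕ → ℤ} (hαβ : α ≠ β) (hβ0 : β ≠ 0)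
    (hnru : ∀ k : ℕ, 0 < k → (α / β) ^ k ≠ 1)
    (ht : ∀ n : ℕ, (t n : ℂ) = (α ^ n - β ^ n) / (α - β)) {n : ℕ} (hn : 0 < n) : t n ≠ 0 := by
  intro h
  have h' := ht n
  rw [h, Int.cast_zero, eq_comm, div_eq_zero_iff] at h'
  rcases h' with h' | h'
  · apply hnru n hn
    rw [div_pow, sub_eq_zero.mp h', div_self (pow_ne_zero _ hβ0)]
  · exact hαβ (sub_eq_zero.mp h')

theorem lucas_pow_eq {s : ℤ} {α β : ℂ} {t : ℕ → ℤ}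
    (hprod : α * β = -(s : ℂ)) (hαβ : α ≠ β)
    (ht : ∀ n : ℕ, (t n : ℂ) = (α ^ n - β ^ n) / (α - β)) (n : ℕ) :
    α ^ (n + 1) = t (n + 1) * α + (s * t n : ℤ) ∧
      β ^ (n + 1) = t (n + 1) * β + (s * t n : ℤ) := by
  have hsub : α - β ≠ 0 := sub_ne_zero.mpr hαβ
  have hs : (s : ℂ) = -(α * β) := by rw [hprod, neg_neg]
  constructor <;>
  · push_cast
    rw [ht, ht, hs]
    field_simp
    ring

/-- A prime not dividing `αβ` that divides `t (n + 1)` does not divide `s * t n`. -/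
theorem not_dvd_of_dvd_lucas {r s : ℤ} {α β : ℂ} {t : ℕ → ℤ}
    (hsum : α + β = (r : ℂ)) (hprod : α * β = -(s : ℂ)) (hαβ : α ≠ β)
    (ht : ∀ n : ℕ, (t n : ℂ) = (α ^ n - β ^ n) / (α - β))
    {p : ℕ} (hp : p.Prime) (hps : ¬ (p : ℤ) ∣ s) {n : ℕ} (hn : (p : ℤ) ∣ t (n + 1)) :
    ¬ (p : ℤ) ∣ s * t n := by
  intro h
  obtain ⟨hα, hβ⟩ := lucas_pow_eq hprod hαβ ht n
  have key : (-s) ^ (n + 1) =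
      t (n + 1) * (-(t (n + 1) * s) + s * t n * r) + s * t n * (s * t n) := by
    have h' : ((-s : ℂ)) ^ (n + 1) =
        t (n + 1) * (-(t (n + 1) * s) + s * t n * r) + s * t n * (s * t n) := by
      rw [← hprod, mul_pow, hα, hβ]
      push_cast
      linear_combination (t (n + 1) : ℂ) ^ 2 * hprod + (t (n + 1) : ℂ) * (s * t n) * hsum
    exact_mod_cast h'
  have hdvd : (p : ℤ) ∣ (-s) ^ (n + 1) := by
    rw [key]
    exact dvd_add (hn.mul_right _) (h.mul_right _)
  exact hps ((dvd_neg).mp ((Nat.prime_iff_prime_int.mp hp).dvd_of_dvd_pow hdvd))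

theorem padicValInt_eq_of_not_dvd {p : ℕ} [Fact p.Prime] {a u : ℤ} (ha : a ≠ 0)
    (hu : ¬ (p : ℤ) ∣ u) : padicValInt p (a * u) = padicValInt p a := by
  have hu0 : u ≠ 0 := by
    rintro rfl
    exact hu (dvd_zero _)
  rw [padicValInt.mul ha hu0, padicValInt.eq_zero_of_not_dvd hu, add_zero]

/-- The law of repetition for Lucas sequences, for any index `m` with `p ∣ t m`. -/
theorem padicValInt_lucas_mul {r s : ℤ} {α β : ℂ} {t : ℕ → ℤ}
    (hsum : α + β = (r : ℂ)) (hprod : α * β = -(s : ℂ)) (hαβ : α ≠ β) (hβ0 : β ≠ 0)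
    (hnru : ∀ k : ℕ, 0 < k → (α / β) ^ k ≠ 1)
    (ht : ∀ n : ℕ, (t n : ℂ) = (α ^ n - β ^ n) / (α - β))
    {p : ℕ} (hp : p.Prime) (hp2 : p ≠ 2) (hps : ¬ (p : ℤ) ∣ s) (k : ℕ) (hk : 0 < k) :
    ∀ m : ℕ, 0 < m → (p : ℤ) ∣ t m →
      padicValInt p (t (m * k)) = padicValInt p (t m) + padicValNat p k := by
  have : Fact p.Prime := ⟨hp⟩
  have hpp : Prime (p : ℤ) := Nat.prime_iff_prime_int.mp hp
  induction k using Nat.strong_induction_on with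
  | _ k ih =>
    intro m hm hpm
    obtain ⟨n, rfl⟩ : ∃ n, m = n + 1 := ⟨m - 1, by omega⟩
    obtain ⟨hα, hβ⟩ := lucas_pow_eq hprod hαβ ht n
    have hc := not_dvd_of_dvd_lucas hsum hprod hαβ ht hp hps hpm
    have hT := lucas_ne_zero hαβ hβ0 hnru ht hm
    set T := t (n + 1)
    set c := s * t n
    by_cases hpk : p ∣ k
    · obtain ⟨q, rfl⟩ := hpk
      have hq : 0 < q := Nat.pos_of_mul_pos_left hk
      have hd : ∀ j, 2 ≤ j → j ≤ p → (p : ℤ) * T ^ 2 ∣ T ^ j * (p.choose j : ℤ) := by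
        intro j hj2 hjp
        rcases hjp.lt_or_eq with hj | rfl
        · rw [mul_comm]
          exact mul_dvd_mul (pow_dvd_pow _ hj2)
            (Int.natCast_dvd_natCast.mpr (hp.dvd_choose_self (by omega) hj))
        · rw [Nat.choose_self, Nat.cast_one, mul_one]
          calc (j : ℤ) * T ^ 2 ∣ T * T ^ 2 := mul_dvd_mul_right hpm _
            _ = T ^ 3 := by ring
            _ ∣ T ^ j := pow_dvd_pow _ (by omega)
      obtain ⟨w, hw⟩ := exists_lucas_mul_eq hαβ ht hα hβ hp.pos hd
      have hw' : t ((n + 1) * p) = p * T * (c ^ (p - 1) + T * w) := by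
        rw [hw]
        ring
      have hu : ¬ (p : ℤ) ∣ c ^ (p - 1) + T * w := fun h =>
        hc (hpp.dvd_of_dvd_pow ((dvd_add_left (hpm.mul_right w)).mp h))
      have hp0 : (p : ℤ) ≠ 0 := hpp.ne_zero
      have hval : padicValInt p (t ((n + 1) * p)) = padicValInt p T + 1 := by
        rw [hw', padicValInt_eq_of_not_dvd (mul_ne_zero hp0 hT) hu, padicValInt.mul hp0 hT,
          padicValInt.self hp.one_lt, add_comm]
      have hlt : q < p * q := lt_mul_of_one_lt_left hq hp.one_lt
      have hdvd : (p : ℤ) ∣ t ((n + 1) * p) := by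
        rw [hw', mul_assoc]
        exact dvd_mul_right _ _
      rw [← mul_assoc, ih q hlt hq _ (Nat.mul_pos hm hp.pos) hdvd, hval,
        padicValNat.mul hp.ne_zero hq.ne', padicValNat_self]
      ring
    · obtain ⟨w, hw⟩ := exists_lucas_mul_eq (d := 1) hαβ ht hα hβ hk
        (fun j hj _ => by
          rw [one_mul]
          exact (pow_dvd_pow _ hj).mul_right _)
      have hw' : t ((n + 1) * k) = T * (k * c ^ (k - 1) + T * w) := by
        rw [hw]
        ring
      have hu : ¬ (p : ℤ) ∣ k * c ^ (k - 1) + T * w := fun h => by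
        rcases hpp.dvd_or_dvd ((dvd_add_left (hpm.mul_right w)).mp h) with h | h
        · exact hpk (Int.natCast_dvd_natCast.mp h)
        · exact hc (hpp.dvd_of_dvd_pow h)
      rw [hw', padicValInt_eq_of_not_dvd hT hu, padicValNat.eq_zero_of_not_dvd hpk, add_zero]


/-- Let `(t n)` be a Lucas sequence with `α + β = r` and `αβ = -s` coprime, `p` an
odd prime not dividing `αβ` and `l` the least positive index with `p ∣ t l`.  If
`n = l * k` with `k > 0`, then `ord_p (t n) = ord_p (t l) + ord_p k`. -/
theorem stmt7 (r s : ℤ) (α β : ℂ) (t : ℕ → ℤ)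
    (hrs : r ^ 2 + 4 * s ≠ 0)
    (hsum : α + β = (r : ℂ)) (hprod : α * β = -(s : ℂ))
    (hαβ : α ≠ β) (hαβ0 : α * β ≠ 0)
    (hnru : ∀ k : ℕ, 0 < k → (α / β) ^ k ≠ 1)
    (ht : ∀ n : ℕ, (t n : ℂ) = (α ^ n - β ^ n) / (α - β))
    (hcop : IsCoprime r s)
    (p : ℕ) (hp : p.Prime) (hp2 : p ≠ 2) (hps : ¬ (p : ℤ) ∣ s)
    (l : ℕ) (hl : IsLeast {n : ℕ | 0 < n ∧ (p : ℤ) ∣ t n} l)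
    (k : ℕ) (hk : 0 < k) :
    padicValInt p (t (l * k)) = padicValInt p (t l) + padicValNat p k := by
  exact padicValInt_lucas_mul hsum hprod hαβ (right_ne_zero_of_mul hαβ0) hnru ht hp hp2 hps k hk l
    hl.1.1 hl.1.2
end

section
/- Let (t_n) be a Lucas sequence with α + β and αβ coprime and with αβ odd (2 does not divide αβ). Let ℓ be the smallest positive integer for which 2 divides t_ℓ. If n = ℓk with k an odd positive integer, then ord_2(t_n) = ord_2(t_ℓ), i.e. |t_n|_2 = |t_ℓ|_2; if n = ℓk with k an even positive integer, then |t_n|_2 = 2·|t_{2ℓ}|_2·|k|_2, i.e. ord_2(t_n) = ord_2(t_{2ℓ}) + ord_2(k) − 1. -/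
/-- The Lucas sequence of the first kind with `u (n + 2) = R * u (n + 1) + S * u n`. -/
def lucasU (R S : ℤ) : ℕ → ℤ
  | 0 => 0
  | 1 => 1
  | n + 2 => R * lucasU R S (n + 1) + S * lucasU R S n

theorem lucasU_add_two (R S : ℤ) (n : ℕ) :
    lucasU R S (n + 2) = R * lucasU R S (n + 1) + S * lucasU R S n := rfl

theorem lucasU_two_mul_and (R S : ℤ) (n : ℕ) :
    lucasU R S (2 * n) = lucasU R S n * (2 * lucasU R S (n + 1) - R * lucasU R S n) ∧
      lucasU R S (2 * n + 1) = lucasU R S (n + 1) ^ 2 + S * lucasU R S n ^ 2 := by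
  induction n with
  | zero => simp [lucasU]
  | succ n ih =>
    obtain ⟨h0, h1⟩ := ih
    have e2 := lucasU_add_two R S (2 * n)
    have e3 := lucasU_add_two R S (2 * n + 1)
    have e := lucasU_add_two R S n
    rw [show 2 * (n + 1) = 2 * n + 2 by ring, show 2 * n + 2 + 1 = 2 * n + 1 + 2 by ring,
      e3, show 2 * n + 1 + 1 = 2 * n + 2 by ring, e2, h0, h1,
      show n + 1 + 1 = n + 2 by ring, e]
    constructor <;> ring

theorem odd_lucasU_and_dvd {R S : ℤ} (hR : Even R) (hS : Odd S) (n : ℕ) :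
    Odd (lucasU R S (2 * n + 1)) ∧ R ∣ lucasU R S (2 * n) := by
  induction n with
  | zero => simp [lucasU]
  | succ n ih =>
    obtain ⟨h1, h0⟩ := ih
    rw [show 2 * (n + 1) = 2 * n + 2 by ring, show 2 * n + 2 + 1 = 2 * n + 1 + 2 by ring,
      lucasU_add_two, lucasU_add_two]
    exact ⟨(hR.mul_right _).add_odd (hS.mul h1), (dvd_mul_right _ _).add (h0.mul_left _)⟩

theorem padicValInt_two_of_odd {a : ℤ} (ha : Odd a) : padicValInt 2 a = 0 :=
  padicValInt.eq_zero_of_not_dvd (by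
    rw [← Int.not_even_iff_odd, even_iff_two_dvd] at ha
    exact_mod_cast ha)

theorem padicValInt_two_mul_odd {a b : ℤ} (hb : Odd b) :
    padicValInt 2 (a * b) = padicValInt 2 a := by
  rcases eq_or_ne a 0 with rfl | ha
  · simp
  · have hb0 : b ≠ 0 := by rintro rfl; simp at hb
    rw [padicValInt.mul ha hb0, padicValInt_two_of_odd hb, add_zero]

theorem padicValInt_two_lucasU_two_mul {R S : ℤ} (hR : Even R) (hS : Odd S)
    (hne : ∀ k, 0 < k → lucasU R S k ≠ 0) (j : ℕ) (hj : 0 < j) :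
    padicValInt 2 (lucasU R S (2 * j)) + 1 = padicValInt 2 R + padicValNat 2 (2 * j) := by
  induction j using Nat.strong_induction_on with
  | _ j ih =>
    rw [(lucasU_two_mul_and R S j).1, padicValNat.mul two_ne_zero hj.ne', padicValNat_self]
    rcases Nat.even_or_odd' j with ⟨i, rfl | rfl⟩
    · have hi : 0 < i := by omega
      obtain ⟨w, hw⟩ := (odd_lucasU_and_dvd hR hS i).1
      obtain ⟨x, hx⟩ := (odd_lucasU_and_dvd hR hS i).2
      obtain ⟨q, hq⟩ := hR.two_dvd
      have hfac : 2 * lucasU R S (2 * i + 1) - R * lucasU R S (2 * i) =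
          2 * (2 * (w - q * q * x) + 1) := by
        rw [hw, hx, hq]; ring
      have h2 : padicValInt 2 (2 * (2 * (w - q * q * x) + 1)) = 1 := by
        rw [padicValInt_two_mul_odd ⟨_, rfl⟩]
        exact padicValInt_self
      rw [hfac, padicValInt.mul (hne _ hj) (by omega), h2]
      have := ih i (by omega) hi
      omega
    · obtain ⟨x, hx⟩ := (odd_lucasU_and_dvd hR hS (i + 1)).2
      have ho := (odd_lucasU_and_dvd hR hS i).1
      have hfac : lucasU R S (2 * i + 1) *
          (2 * lucasU R S (2 * i + 1 + 1) - R * lucasU R S (2 * i + 1)) =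
          R * ((2 * x - lucasU R S (2 * i + 1)) * lucasU R S (2 * i + 1)) := by
        rw [show 2 * i + 1 + 1 = 2 * (i + 1) by ring, hx]; ring
      rw [hfac, padicValInt_two_mul_odd (((even_two_mul x).sub_odd ho).mul ho),
        padicValNat.eq_zero_of_not_dvd (n := 2 * i + 1) (by omega)]

theorem eq_mul_lucasU {R S : ℤ} {l : ℕ} {t : ℕ → ℤ} (h0 : t 0 = 0)
    (h : ∀ n, t (n + 2 * l) = R * t (n + l) + S * t n) (k : ℕ) :
    t (l * k) = t l * lucasU R S k := by
  induction k using Nat.twoStepInduction with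
  | zero => simp [lucasU, h0]
  | one => simp [lucasU]
  | more k ih0 ih1 =>
    rw [lucasU_add_two, show l * (k + 2) = l * k + 2 * l by ring, h,
      show l * k + l = l * (k + 1) by ring, ih0, ih1]
    ring

theorem padicValInt_two_mul_index {R S : ℤ} {l : ℕ} {t : ℕ → ℤ} (hR : Even R) (hS : Odd S)
    (hl : 0 < l) (h0 : t 0 = 0) (hne : ∀ n, 0 < n → t n ≠ 0)
    (h : ∀ n, t (n + 2 * l) = R * t (n + l) + S * t n) :
    (∀ k : ℕ, Odd k →
        padicValInt 2 (t (l * k)) = padicValInt 2 (t l)) ∧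
      (∀ k : ℕ, 0 < k → Even k →
        padicValInt 2 (t (l * k)) + 1 = padicValInt 2 (t (2 * l)) + padicValNat 2 k) := by
  have key := eq_mul_lucasU h0 h
  have hu : ∀ k, 0 < k → lucasU R S k ≠ 0 := fun k hk hk0 =>
    hne (l * k) (Nat.mul_pos hl hk) (by rw [key, hk0, mul_zero])
  refine ⟨?_, ?_⟩
  · rintro _ ⟨i, rfl⟩
    rw [key, padicValInt_two_mul_odd (odd_lucasU_and_dvd hR hS i).1]
  · intro k hk hk2
    obtain ⟨j, rfl⟩ := hk2.two_dvd
    have hu2 : lucasU R S 2 = R := by simp [lucasU]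
    have hR0 : R ≠ 0 := hu2 ▸ hu 2 two_pos
    rw [mul_comm 2 l, key, key, hu2, padicValInt.mul (hne l hl) (hu _ hk),
      padicValInt.mul (hne l hl) hR0, add_assoc,
      padicValInt_two_lucasU_two_mul hR hS hu j (by omega), add_assoc]

/-- Let `(t n)` be a Lucas sequence with `α + β = r` and `αβ = -s` coprime and `αβ`
odd, and let `l` be the least positive index with `2 ∣ t l`.  If `n = l * k` with `k`
odd then `ord_2 (t n) = ord_2 (t l)`, while if `k` is even and positive then
`ord_2 (t n) = ord_2 (t (2l)) + ord_2 k - 1`. -/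
theorem stmt8 (r s : ℤ) (α β : ℂ) (t : ℕ → ℤ)
    (hrs : r ^ 2 + 4 * s ≠ 0)
    (hsum : α + β = (r : ℂ)) (hprod : α * β = -(s : ℂ))
    (hαβ : α ≠ β) (hαβ0 : α * β ≠ 0)
    (hnru : ∀ k : ℕ, 0 < k → (α / β) ^ k ≠ 1)
    (ht : ∀ n : ℕ, (t n : ℂ) = (α ^ n - β ^ n) / (α - β))
    (hcop : IsCoprime r s)
    (hps : ¬ (2 : ℤ) ∣ s)
    (l : ℕ) (hl : IsLeast {n : ℕ | 0 < n ∧ (2 : ℤ) ∣ t n} l) :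
    (∀ k : ℕ, Odd k →
        padicValInt 2 (t (l * k)) = padicValInt 2 (t l)) ∧
      (∀ k : ℕ, 0 < k → Even k →
        padicValInt 2 (t (l * k)) + 1 = padicValInt 2 (t (2 * l)) + padicValNat 2 k) := by
  have hd : α - β ≠ 0 := sub_ne_zero.mpr hαβ
  have hβ : β ≠ 0 := right_ne_zero_of_mul hαβ0
  have h0 : t 0 = 0 := by
    have := ht 0
    simpa using this
  have h1 : t 1 = 1 := by
    have := ht 1
    rw [pow_one, pow_one, div_self hd] at this
    exact_mod_cast this
  have hrec : ∀ n, t (n + 2) = r * t (n + 1) + s * t n := by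
    intro n
    have : (t (n + 2) : ℂ) = r * t (n + 1) + s * t n := by
      have hs : (s : ℂ) = -(α * β) := by rw [hprod, neg_neg]
      rw [ht, ht, ht, ← hsum, hs]
      field_simp
      ring
    exact_mod_cast this
  have hne : ∀ n, 0 < n → t n ≠ 0 := by
    intro n hn h
    have h' := ht n
    rw [h, Int.cast_zero, eq_comm, div_eq_zero_iff, or_iff_left hd, sub_eq_zero] at h'
    exact hnru n hn (by rw [div_pow, h', div_self (pow_ne_zero _ hβ)])
  have h2 : t 2 = r := by simp [hrec 0, h0, h1]
  have h3 : t 3 = r ^ 2 + s := by rw [hrec 1, h2, h1]; ring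
  have hs : Odd s := by rwa [← Int.not_even_iff_odd, even_iff_two_dvd]
  obtain ⟨⟨hl0, hl2⟩, hmin⟩ := hl
  have hl1 : l ≠ 1 := by
    rintro rfl
    rw [h1] at hl2
    omega
  rcases Int.even_or_odd r with hr | hr
  · have hle : l ≤ 2 := hmin ⟨two_pos, by rw [h2]; exact hr.two_dvd⟩
    obtain rfl : l = 2 := by omega
    refine padicValInt_two_mul_index (R := r ^ 2 + 2 * s) (S := -s ^ 2)
      ((hr.pow_of_ne_zero two_ne_zero).add (even_two_mul s)) hs.pow.neg hl0 h0 hne fun n => ?_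
    linear_combination hrec (n + 2) + r * hrec (n + 1) - s * hrec n
  · have hle : l ≤ 3 := hmin ⟨three_pos, by
      rw [h3]; exact (hr.pow.add_odd hs).two_dvd⟩
    have hl2' : l ≠ 2 := by
      rintro rfl
      rw [h2, ← even_iff_two_dvd, ← Int.not_odd_iff_even] at hl2
      exact hl2 hr
    obtain rfl : l = 3 := by omega
    have hR : Even (r ^ 3 + 3 * r * s) :=
      hr.pow.add_odd (((by decide : Odd (3 : ℤ)).mul hr).mul hs)
    refine padicValInt_two_mul_index (R := r ^ 3 + 3 * r * s) (S := s ^ 3)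
      hR hs.pow hl0 h0 hne fun n => ?_
    linear_combination hrec (n + 4) + r * hrec (n + 3) + (r ^ 2 + s) * hrec (n + 2)
      - r * s * hrec (n + 1) + s ^ 2 * hrec n
end

section
/- Let n and e be positive integers and let i be an integer with gcd(i, e) = 1. For each divisor m of n with gcd(m, e) = 1, let \bar{m} denote an integer with m·\bar{m} ≡ i (mod e). Then for all complex numbers x, y with y ≠ 0 and x/y not a root of unity: Φ_{n,e}^{(i)}(x, y) = ∏_{m | n, gcd(m,e)=1} (x^{n/m} − ζ_e^{\bar{m}}·y^{n/m})^{μ(m)}, where μ is the Möbius function. In particular, Φ_{n,e}^{(i)}(x, y), as a polynomial in x and y, has all its coefficients in the ring ℤ[ζ_e]. -/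
/-- `Φ_{n,e}^{(i)}(x, y) = ∏_{1 ≤ j ≤ ne, gcd(j,ne)=1, j ≡ i (mod e)} (x - ζ_{ne}^j y)`
where `ζ_{ne} = e^{2πi/(ne)}`. -/
noncomputable def cycloSection (n e : ℕ) (i : ℤ) (x y : ℂ) : ℂ :=
  ∏ j ∈ (Finset.Icc 1 (n * e)).filter
      (fun j => Nat.Coprime j (n * e) ∧ (j : ℤ) ≡ i [ZMOD (e : ℤ)]),
    (x - Complex.exp (2 * Real.pi * Complex.I * j / (n * e)) * y)

open Finset Polynomial ArithmeticFunction in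
/-- The linear forms `x - ζ_{Ne}^k y` with `k ≡ b (mod e)` multiply to `x^N - ζ_e^b y^N`. -/
theorem prod_filter_modEq_sub_mul (N e : ℕ) (hN : 0 < N) (he : 0 < e) (b : ℤ) (x y : ℂ) :
    ∏ k ∈ (Icc 1 (N * e)).filter (fun k : ℕ => (k : ℤ) ≡ b [ZMOD (e : ℤ)]),
      (x - Complex.exp (2 * Real.pi * Complex.I * k / (N * e)) * y) =
    x ^ N - (Complex.exp (2 * Real.pi * Complex.I / e)) ^ b * y ^ N := by
  have hN' : (N : ℂ) ≠ 0 := by exact_mod_cast hN.ne'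
  have he' : (e : ℂ) ≠ 0 := by exact_mod_cast he.ne'
  have heZ : (0 : ℤ) < e := by exact_mod_cast he
  obtain ⟨b₀, hb1, hb2, hb⟩ : ∃ b₀ : ℕ, 1 ≤ b₀ ∧ b₀ ≤ e ∧ ((b₀ : ℤ) ≡ b [ZMOD (e : ℤ)]) := by
    have h0 := Int.emod_nonneg (b - 1) heZ.ne'
    have h1 := Int.emod_lt_of_pos (b - 1) heZ
    refine ⟨((b - 1) % e).toNat + 1, by omega, by omega, ?_⟩
    push_cast
    rw [Int.toNat_of_nonneg h0]
    simpa using (Int.mod_modEq (b - 1) e).add_right 1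
  have hζ : (Complex.exp (2 * Real.pi * Complex.I / e)) ^ b =
      (Complex.exp (2 * Real.pi * Complex.I / e)) ^ b₀ := by
    obtain ⟨t, ht⟩ := hb.dvd
    rw [show b = b₀ + e * t by linarith, zpow_add₀ (Complex.exp_ne_zero _), zpow_mul,
      zpow_natCast, zpow_natCast, (Complex.isPrimitiveRoot_exp e he.ne').pow_eq_one, one_zpow,
      mul_one]
  have hset : (Icc 1 (N * e)).filter (fun k : ℕ => (k : ℤ) ≡ b [ZMOD (e : ℤ)]) =
      (range N).image (fun t => b₀ + e * t) := by
    ext k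
    simp only [mem_filter, mem_Icc, mem_image, mem_range]
    constructor
    · rintro ⟨⟨hk1, hk2⟩, hk⟩
      obtain ⟨t, ht⟩ := (hb.trans hk.symm).dvd
      have ht0 : 0 ≤ t := by
        by_contra! h
        nlinarith
      lift t to ℕ using ht0
      have hkt : b₀ + e * t = k := by zify; linarith
      refine ⟨t, ?_, hkt⟩
      by_contra! h
      nlinarith
    · rintro ⟨t, ht, rfl⟩
      refine ⟨⟨by omega, by nlinarith⟩, ?_⟩
      push_cast
      simpa using hb.add (Int.modEq_zero_iff_dvd.mpr (dvd_mul_right (e : ℤ) t))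
  rw [hset, prod_image (fun s _ t _ h => Nat.eq_of_mul_eq_mul_left he (Nat.add_left_cancel h)), hζ]
  have key := X_pow_sub_C_eq_prod (Complex.isPrimitiveRoot_exp N hN.ne')
    (α := Complex.exp (2 * Real.pi * Complex.I * b₀ / (N * e)) * y)
    (a := (Complex.exp (2 * Real.pi * Complex.I / e)) ^ b₀ * y ^ N) hN (by
      rw [mul_pow, ← Complex.exp_nat_mul, ← Complex.exp_nat_mul]
      congr 2
      field_simp)
  have := congrArg (Polynomial.eval x) key
  simp only [eval_sub, eval_pow, eval_X, eval_C, eval_prod] at this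
  rw [this]
  refine prod_congr rfl fun t _ => ?_
  rw [← mul_assoc, ← Complex.exp_nat_mul, ← Complex.exp_add]
  congr 3
  push_cast
  field_simp
  ring

open ArithmeticFunction in
theorem sum_moebius_divisors_filter_dvd (n j : ℕ) (hn : 0 < n) :
    ∑ m ∈ n.divisors.filter (fun m => m ∣ j), moebius m = if Nat.Coprime j n then 1 else 0 := by
  have h : n.divisors.filter (fun m => m ∣ j) = (j.gcd n).divisors := by
    ext m
    simp [Nat.dvd_gcd_iff, hn.ne', and_comm]
  rw [h, ← coe_mul_zeta_apply, moebius_mul_coe_zeta, one_apply]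

theorem Finset.prod_zpow_eq_zpow_sum {ι K : Type*} [CommGroupWithZero K] {a : K} (ha : a ≠ 0)
    (s : Finset ι) (f : ι → ℤ) : ∏ k ∈ s, a ^ f k = a ^ ∑ k ∈ s, f k := by
  classical
  induction s using Finset.induction_on with
  | empty => simp
  | insert k s hk ih => rw [prod_insert hk, sum_insert hk, ih, zpow_add₀ ha]

theorem coprime_of_intGcd_of_modEq {j e : ℕ} {i : ℤ} (hi : Int.gcd i (e : ℤ) = 1)
    (hj : (j : ℤ) ≡ i [ZMOD (e : ℤ)]) : Nat.Coprime j e := by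
  obtain ⟨t, ht⟩ := hj.dvd
  rw [← Int.isCoprime_iff_gcd_eq_one, show i = j + e * t by linarith] at hi
  exact Nat.isCoprime_iff_coprime.mp hi.of_add_mul_left_left

open Finset ArithmeticFunction in
theorem cycloSection_eq_prod_zpow_moebius (n e : ℕ) (hn : 0 < n) (he : 0 < e) (i : ℤ)
    (hi : Int.gcd i (e : ℤ) = 1) (mb : ℕ → ℤ)
    (hmb : ∀ m : ℕ, m ∣ n → Nat.Coprime m e → (m : ℤ) * mb m ≡ i [ZMOD (e : ℤ)])
    (x y : ℂ) (hy : y ≠ 0) (hxy : ∀ k : ℕ, 0 < k → (x / y) ^ k ≠ 1) :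
    cycloSection n e i x y =
      ∏ m ∈ n.divisors.filter (fun m => Nat.Coprime m e),
        (x ^ (n / m) - (Complex.exp (2 * Real.pi * Complex.I / e)) ^ (mb m)
          * y ^ (n / m)) ^ (moebius m) := by
  have hne : 0 < n * e := Nat.mul_pos hn he
  have hn' : (n : ℂ) ≠ 0 := by exact_mod_cast hn.ne'
  have he' : (e : ℂ) ≠ 0 := by exact_mod_cast he.ne'
  set f : ℕ → ℂ := fun j => x - Complex.exp (2 * Real.pi * Complex.I * j / (n * e)) * y with hf
  have hf0 : ∀ j, f j ≠ 0 := by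
    intro j hj
    apply hxy (n * e) hne
    have : x / y = Complex.exp (2 * Real.pi * Complex.I * j / (n * e)) := by
      rw [div_eq_iff hy]
      exact sub_eq_zero.mp hj
    rw [this, ← Complex.exp_nat_mul, Complex.exp_eq_one_iff]
    refine ⟨j, ?_⟩
    push_cast
    field_simp
  set S := (Icc 1 (n * e)).filter (fun j : ℕ => (j : ℤ) ≡ i [ZMOD (e : ℤ)]) with hS
  have h1 : cycloSection n e i x y =
      ∏ j ∈ S, f j ^ (if Nat.Coprime j n then (1 : ℤ) else 0) := by
    have : (Icc 1 (n * e)).filter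
        (fun j => Nat.Coprime j (n * e) ∧ (j : ℤ) ≡ i [ZMOD (e : ℤ)]) =
        S.filter (fun j => Nat.Coprime j n) := by
      ext j
      simp only [hS, mem_filter, Nat.coprime_mul_iff_right]
      constructor
      · tauto
      · rintro ⟨⟨h1, h2⟩, h3⟩
        exact ⟨h1, ⟨h3, coprime_of_intGcd_of_modEq hi h2⟩, h2⟩
    rw [cycloSection, this, prod_filter]
    refine prod_congr rfl fun j _ => ?_
    split_ifs <;> simp [hf]
  have h2 : ∀ j ∈ S, f j ^ (if Nat.Coprime j n then (1 : ℤ) else 0) =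
      ∏ m ∈ n.divisors.filter (fun m => Nat.Coprime m e),
        if m ∣ j then f j ^ moebius m else 1 := by
    intro j hj
    rw [← sum_moebius_divisors_filter_dvd n j hn, ← prod_zpow_eq_zpow_sum (hf0 j), ← prod_filter,
      filter_filter]
    refine prod_congr (filter_congr fun m _ => ⟨fun h => ⟨?_, h⟩, fun h => h.2⟩) fun _ _ => rfl
    exact (coprime_of_intGcd_of_modEq hi (mem_filter.mp hj).2).coprime_dvd_left h
  rw [h1, prod_congr rfl h2, prod_comm]
  refine prod_congr rfl fun m hm => ?_
  obtain ⟨⟨hmn, -⟩, hme⟩ : (m ∣ n ∧ n ≠ 0) ∧ Nat.Coprime m e := by simpa using hm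
  obtain ⟨N, rfl⟩ := hmn
  have hm0 : 0 < m := Nat.pos_of_mul_pos_right hn
  have hN0 : 0 < N := Nat.pos_of_mul_pos_left hn
  have hm' : (m : ℂ) ≠ 0 := by exact_mod_cast hm0.ne'
  rw [← prod_filter, prod_zpow, Nat.mul_div_cancel_left N hm0,
    ← prod_filter_modEq_sub_mul N e hN0 he]
  congr 1
  have hset : S.filter (fun j => m ∣ j) =
      ((Icc 1 (N * e)).filter (fun k : ℕ => (k : ℤ) ≡ mb m [ZMOD (e : ℤ)])).image
        (fun k => m * k) := by
    ext j
    simp only [hS, mem_filter, mem_Icc, mem_image]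
    have hmb' := hmb m (dvd_mul_right m N) hme
    constructor
    · rintro ⟨⟨⟨hj1, hj2⟩, hj⟩, k, rfl⟩
      refine ⟨k, ⟨⟨Nat.pos_of_mul_pos_left hj1, ?_⟩, ?_⟩, rfl⟩
      · rw [mul_assoc] at hj2
        exact Nat.le_of_mul_le_mul_left hj2 hm0
      · push_cast at hj
        have h := (hj.trans hmb'.symm).dvd
        rw [← mul_sub] at h
        refine Int.modEq_iff_dvd.mpr (IsCoprime.dvd_of_dvd_mul_left ?_ h)
        exact (Nat.isCoprime_iff_coprime.mpr hme).symm
    · rintro ⟨k, ⟨⟨hk1, hk2⟩, hk⟩, rfl⟩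
      refine ⟨⟨⟨Nat.mul_pos hm0 hk1, ?_⟩, ?_⟩, dvd_mul_right m k⟩
      · rw [mul_assoc]
        exact Nat.mul_le_mul_left m hk2
      · push_cast
        exact (hk.mul_left _).trans hmb'
  rw [hset, prod_image (fun s _ t _ h => Nat.eq_of_mul_eq_mul_left hm0 h)]
  refine prod_congr rfl fun k _ => ?_
  simp only [hf]
  congr 3
  push_cast
  field_simp

open Polynomial in
/-- The quotient of two polynomials over a subring, with monic denominator, has its coefficients
in the subring. -/
theorem Polynomial.coeff_mem_of_mul_map_eq_map {K : Type*} [CommRing K] {A : Type*} [CommRing A]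
    [Algebra A K] (R : Subalgebra A K) {F : K[X]} {a b : R[X]} (hb : b.Monic)
    (h : b.map (algebraMap R K) * F = a.map (algebraMap R K)) (k : ℕ) : F.coeff k ∈ R := by
  have : F = (a /ₘ b).map (algebraMap R K) := by
    rw [map_divByMonic _ hb, ← h, mul_divByMonic_cancel_left _ (hb.map _)]
  rw [this, coeff_map]
  exact ((a /ₘ b).coeff k).2

theorem exp_zpow_mem_adjoin (e : ℕ) (he : 0 < e) (b : ℤ) :
    Complex.exp (2 * Real.pi * Complex.I / e) ^ b ∈
      Algebra.adjoin ℤ ({Complex.exp (2 * Real.pi * Complex.I / e)} : Set ℂ) := by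
  have heZ : (e : ℤ) ≠ 0 := by exact_mod_cast he.ne'
  have h1 := (Complex.isPrimitiveRoot_exp e he.ne').pow_eq_one
  have h : Complex.exp (2 * Real.pi * Complex.I / e) ^ b =
      Complex.exp (2 * Real.pi * Complex.I / e) ^ (b % e).toNat := by
    rw [← zpow_natCast _ (b % e).toNat, Int.toNat_of_nonneg (Int.emod_nonneg b heZ)]
    conv_lhs => rw [← Int.emod_add_mul_ediv b e]
    rw [zpow_add₀ (Complex.exp_ne_zero _), zpow_mul, zpow_natCast, h1, one_zpow, mul_one]
  rw [h]
  exact pow_mem (Algebra.self_mem_adjoin_singleton ℤ _) _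

theorem zpow_moebius_mul {K : Type*} [Field K] (m : ℕ) {a : K} (ha : a ≠ 0) :
    (if ArithmeticFunction.moebius m = -1 then a else 1) * a ^ ArithmeticFunction.moebius m =
      if ArithmeticFunction.moebius m = 1 then a else 1 := by
  rcases ArithmeticFunction.moebius_eq_or m with h | h | h <;> simp [h, ha]

open Finset Polynomial ArithmeticFunction in
theorem coeff_prod_X_sub_C_mem_adjoin (n e : ℕ) (hn : 0 < n) (he : 0 < e) (i : ℤ)
    (hi : Int.gcd i (e : ℤ) = 1) (mb : ℕ → ℤ)
    (hmb : ∀ m : ℕ, m ∣ n → Nat.Coprime m e → (m : ℤ) * mb m ≡ i [ZMOD (e : ℤ)]) (k : ℕ) :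
    (∏ j ∈ (Icc 1 (n * e)).filter
      (fun j => Nat.Coprime j (n * e) ∧ (j : ℤ) ≡ i [ZMOD (e : ℤ)]),
      (X - C (Complex.exp (2 * Real.pi * Complex.I * j / (n * e))))).coeff k ∈
        Algebra.adjoin ℤ ({Complex.exp (2 * Real.pi * Complex.I / e)} : Set ℂ) := by
  set R := Algebra.adjoin ℤ ({Complex.exp (2 * Real.pi * Complex.I / e)} : Set ℂ)
  set D := n.divisors.filter (fun m => Nat.Coprime m e) with hD
  let g : ℕ → R[X] := fun m => X ^ (n / m) - C ⟨_, exp_zpow_mem_adjoin e he (mb m)⟩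
  have hg : ∀ m ∈ D, (g m).Monic := by
    intro m hm
    have hmn : m ∣ n := Nat.dvd_of_mem_divisors (mem_filter.mp hm).1
    exact monic_X_pow_sub_C _ (Nat.div_pos (Nat.le_of_dvd hn hmn)
      (Nat.pos_of_dvd_of_pos hmn hn)).ne'
  refine coeff_mem_of_mul_map_eq_map R (a := ∏ m ∈ D, if moebius m = 1 then g m else 1)
    (b := ∏ m ∈ D, if moebius m = -1 then g m else 1)
    (monic_prod_of_monic _ _ fun m hm => ?_) ?_ k
  · split_ifs
    exacts [hg m hm, monic_one]
  refine eq_of_infinite_eval_eq _ _ (Set.Infinite.mono ?_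
    ((Set.infinite_range_of_injective (f := fun t : ℕ => (t : ℂ) + 2)
      fun s t h => by simpa using h)))
  rintro _ ⟨t, rfl⟩
  have hroot : ∀ k : ℕ, 0 < k → (((t : ℂ) + 2) / 1) ^ k ≠ 1 := by
    intro k hk h
    rw [div_one] at h
    have h' : (t + 2) ^ k = 1 := by exact_mod_cast h
    have := Nat.one_lt_pow hk.ne' (show 1 < t + 2 by omega)
    omega
  have hF := cycloSection_eq_prod_zpow_moebius n e hn he i hi mb hmb (t + 2) 1 one_ne_zero hroot
  simp only [cycloSection, mul_one, one_pow] at hF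
  have hne : ∀ m ∈ D, ((t : ℂ) + 2) ^ (n / m) -
      Complex.exp (2 * Real.pi * Complex.I / e) ^ mb m ≠ 0 := by
    intro m hm h
    have hmn : m ∣ n := Nat.dvd_of_mem_divisors (mem_filter.mp hm).1
    have hpos := Nat.div_pos (Nat.le_of_dvd hn hmn) (Nat.pos_of_dvd_of_pos hmn hn)
    apply hroot (n / m * e) (Nat.mul_pos hpos he)
    rw [div_one, pow_mul, sub_eq_zero.mp h, ← zpow_natCast, zpow_comm, zpow_natCast,
      (Complex.isPrimitiveRoot_exp e he.ne').pow_eq_one, one_zpow]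
  have heval : ∀ m, ((g m).map (algebraMap R ℂ)).eval ((t : ℂ) + 2) = ((t : ℂ) + 2) ^ (n / m) -
      Complex.exp (2 * Real.pi * Complex.I / e) ^ mb m := by
    intro m
    simp only [g, Polynomial.map_sub, Polynomial.map_pow, map_X, map_C, eval_sub, eval_pow, eval_X,
      eval_C]
    rfl
  have hite : ∀ (m : ℕ) (p : Prop) [Decidable p],
      eval ((t : ℂ) + 2) ((if p then g m else 1).map (algebraMap R ℂ)) =
        if p then ((t : ℂ) + 2) ^ (n / m) -
          Complex.exp (2 * Real.pi * Complex.I / e) ^ mb m else 1 := by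
    intro m p _
    split_ifs
    · exact heval m
    · simp
  simp only [Set.mem_ofPred_eq, eval_mul, Polynomial.map_prod, eval_prod, eval_sub, eval_X, eval_C,
    hite]
  rw [hF, ← prod_mul_distrib]
  exact prod_congr rfl fun m hm => zpow_moebius_mul m (hne m hm)

open Polynomial in
theorem Polynomial.eval_homogenize_prod_X_sub_C {ι K : Type*} [CommRing K] [Nontrivial K]
    (s : Finset ι) (c : ι → K) (x y : K) :
    MvPolynomial.eval ![x, y] ((∏ j ∈ s, (X - C (c j))).homogenize (∑ _j ∈ s, 1)) =
      ∏ j ∈ s, (x - c j * y) := by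
  have h : ∀ j ∈ s, (X - C (c j)).natDegree ≤ (fun _ : ι => 1) j :=
    fun j _ => (natDegree_X_sub_C (c j)).le
  rw [homogenize_finsetProd h, map_prod]
  simp [homogenize_sub]

/-- Let `n, e` be positive integers, `gcd(i, e) = 1`, and for each divisor `m` of `n`
coprime to `e` let `mb m` satisfy `m * mb m ≡ i (mod e)`.  Then for complex `x, y`
with `y ≠ 0` and `x/y` not a root of unity,
`Φ_{n,e}^{(i)}(x,y) = ∏_{m ∣ n, gcd(m,e)=1} (x^{n/m} - ζ_e^{mb m} y^{n/m})^{μ(m)}`;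
in particular `Φ_{n,e}^{(i)}`, as a polynomial in `x` and `y`, has all its
coefficients in `ℤ[ζ_e]`. -/
theorem stmt17 (n e : ℕ) (hn : 0 < n) (he : 0 < e) (i : ℤ)
    (hi : Int.gcd i (e : ℤ) = 1)
    (mb : ℕ → ℤ)
    (hmb : ∀ m : ℕ, m ∣ n → Nat.Coprime m e → (m : ℤ) * mb m ≡ i [ZMOD (e : ℤ)]) :
    (∀ x y : ℂ, y ≠ 0 → (∀ k : ℕ, 0 < k → (x / y) ^ k ≠ 1) →
      cycloSection n e i x y =
        ∏ m ∈ n.divisors.filter (fun m => Nat.Coprime m e),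
          (x ^ (n / m) - (Complex.exp (2 * Real.pi * Complex.I / e)) ^ (mb m)
            * y ^ (n / m)) ^ (ArithmeticFunction.moebius m)) ∧
    ∃ Q : MvPolynomial (Fin 2) ℂ,
      (∀ d : Fin 2 →₀ ℕ, MvPolynomial.coeff d Q ∈
        Algebra.adjoin ℤ ({Complex.exp (2 * Real.pi * Complex.I / e)} : Set ℂ)) ∧
      ∀ x y : ℂ, MvPolynomial.eval ![x, y] Q = cycloSection n e i x y := by
  refine ⟨cycloSection_eq_prod_zpow_moebius n e hn he i hi mb hmb, ?_⟩
  set S := (Finset.Icc 1 (n * e)).filter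
    (fun j => Nat.Coprime j (n * e) ∧ (j : ℤ) ≡ i [ZMOD (e : ℤ)]) with hS
  refine ⟨(∏ j ∈ S, (Polynomial.X - Polynomial.C
    (Complex.exp (2 * Real.pi * Complex.I * j / (n * e))))).homogenize (∑ _j ∈ S, 1), ?_, ?_⟩
  · intro d
    rw [Polynomial.coeff_homogenize]
    split_ifs
    · exact coeff_prod_X_sub_C_mem_adjoin n e hn he i hi mb hmb _
    · exact zero_mem _
  · exact fun x y => Polynomial.eval_homogenize_prod_X_sub_C S _ x y
end
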